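/- arXiv:math-ph/0410052 — 6 statements merged into one kernel-verified Lean document; each statement's English description precedes it below -/
import Mathlib

section
/- For every k ≥ 1, ν(B_k) ≤ 2^{−k/2}, the series Σ_k ν(B_k) converges, and hence ν(B) = 0. Moreover, H(ζ) < ∞ for every ζ ∈ Ω such that the configuration (ζ_1, ζ_2, …) agrees off site 0 with some ω ∉ B; in particular H(ω) < ∞ and H(1ω) < ∞ for every ω ∉ B, so H is finite ν-almost everywhere. -/
open MeasureTheory Filter Topology
open scoped ENNReal

namespace WeakGibbsExample

/-- Configuration space `Ω = {0,1}^{ℤ≥0}`. -/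
abbrev Conf := ℕ → Bool

/-- `ν` is the Bernoulli(1/2,1/2) product measure on `{0,1}^{ℤ≥0}`:
a probability measure giving each cylinder on a finite set `s` measure `2^{-|s|}`. -/
def IsBernoulliHalf (ν : Measure Conf) : Prop :=
  IsProbabilityMeasure ν ∧
    ∀ (s : Finset ℕ) (f : ℕ → Bool),
      ν {ζ | ∀ i ∈ s, ζ i = f i} = (2 : ℝ≥0∞)⁻¹ ^ s.card

/-- `N_m(ω)`: the length of the maximal run of `1`s in `ω` ending at site `m`
(`0` if `ω m = 0`). -/
def runLen (ω : Conf) (m : ℕ) : ℕ :=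
  Nat.findGreatest (fun j => 0 < j ∧ ∀ i < j, ω (m - i) = true) (m + 1)

/-- The potential term `U([0,2p], ω) = ω_0 ω_{2p} ρ^{p - N_{2p}(ω)} 𝟙{N_{2p}(ω) ≤ p}`. -/
noncomputable def U (ρ : ℝ) (ω : Conf) (p : ℕ) : ℝ :=
  if ω 0 = true ∧ ω (2 * p) = true ∧ runLen ω (2 * p) ≤ p then
    ρ ^ (p - runLen ω (2 * p))
  else 0

/-- The Hamiltonian `H(ω) = Σ_{n ≥ 1} U([0,2n], ω) ∈ [0,∞]`. -/
noncomputable def H (ρ : ℝ) (ω : Conf) : ℝ≥0∞ :=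
  ∑' n : ℕ, ENNReal.ofReal (U ρ ω (n + 1))

/-- `B_k = {η : η_j = 1 for all ⌊3k/2⌋ ≤ j ≤ 2k}`. -/
def Bk (k : ℕ) : Set Conf :=
  {η | ∀ j, 3 * k / 2 ≤ j → j ≤ 2 * k → η j = true}

/-- `B = ⋂_K ⋃_{k ≥ K} B_k`. -/
def Bbad : Set Conf :=
  ⋂ K : ℕ, ⋃ k : ℕ, ⋃ _ : K ≤ k, Bk k

/-- `b ζ`: the configuration with symbol `b` at site `0` and agreeing with `ζ` on sites `≥ 1`. -/
def consb (b : Bool) (ζ : Conf) : Conf := fun i => if i = 0 then b else ζ i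

/-- `1ζ`. -/
def one (ζ : Conf) : Conf := consb true ζ

/-- The glued configuration equal to `ω` on `[0,n]` and to `η` on `[n+1,∞)`. -/
def glue (ω η : Conf) (n : ℕ) : Conf := fun i => if i ≤ n then ω i else η i

/-- `γ_0(b | ζ_{[1,∞)})`, the single-site conditional probability computed from the
Hamiltonian (the value of `ζ` at site `0` is ignored). -/
noncomputable def gamma0 (ρ : ℝ) (b : Bool) (ζ : Conf) : ℝ :=
  if b then
    Real.exp (-(H ρ (one ζ)).toReal) / (1 + Real.exp (-(H ρ (one ζ)).toReal))
  else 1 / (1 + Real.exp (-(H ρ (one ζ)).toReal))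

/-- The cylinder `[ω_{[1,n]}] = {ζ : ζ_i = ω_i for 1 ≤ i ≤ n}`. -/
def cylTail (ω : Conf) (n : ℕ) : Set Conf :=
  {ζ | ∀ i, 1 ≤ i → i ≤ n → ζ i = ω i}

/-- `A^ω_{ε,n}`: the set of exterior configurations `η` for which the glued configuration
`ω_{[1,n]} η_{[n+1,∞)}` moves the single-site conditional probabilities by more than `ε`. -/
noncomputable def Abad (ρ : ℝ) (ω : Conf) (ε : ℝ) (n : ℕ) : Set Conf :=
  {η | ∃ b : Bool, ε < |gamma0 ρ b (glue ω η n) - gamma0 ρ b ω|}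

/-- The density `exp(-H(ζ))` (equal to `0` when `H(ζ) = ∞`). -/
noncomputable def expH (ρ : ℝ) (ζ : Conf) : ℝ≥0∞ :=
  if H ρ ζ = ⊤ then 0 else ENNReal.ofReal (Real.exp (-(H ρ ζ).toReal))


theorem Bk_eq_cylinder (k : ℕ) :
    Bk k = {ζ : Conf | ∀ i ∈ Finset.Icc (3 * k / 2) (2 * k), ζ i = true} := by
  ext η
  simp [Bk]

theorem measure_Bk_le {ν : Measure Conf} (hν : IsBernoulliHalf ν) (k : ℕ) :
    ν (Bk k) ≤ ENNReal.ofReal ((2 : ℝ) ^ (-(k : ℝ) / 2)) := by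
  rw [Bk_eq_cylinder, hν.2 _ fun _ => true]
  have h2 : (2 : ℝ≥0∞)⁻¹ = ENNReal.ofReal ((2 : ℝ)⁻¹) := by
    rw [ENNReal.ofReal_inv_of_pos (by norm_num)]
    simp
  rw [h2, ← ENNReal.ofReal_pow (by norm_num)]
  apply ENNReal.ofReal_le_ofReal
  rw [inv_pow, ← Real.rpow_natCast, ← Real.rpow_neg (by norm_num)]
  apply Real.rpow_le_rpow_of_exponent_le (by norm_num)
  have h : k ≤ 2 * (Finset.Icc (3 * k / 2) (2 * k)).card := by
    rw [Nat.card_Icc]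
    omega
  have h' : (k : ℝ) ≤ 2 * ((Finset.Icc (3 * k / 2) (2 * k)).card : ℝ) := by exact_mod_cast h
  linarith

theorem tsum_measure_Bk_lt_top {ν : Measure Conf} (hν : IsBernoulliHalf ν) :
    (∑' k : ℕ, ν (Bk k)) < ⊤ := by
  refine (ENNReal.tsum_le_tsum (measure_Bk_le hν)).trans_lt (Summable.tsum_ofReal_lt_top ?_)
  have h : ∀ k : ℕ, (2 : ℝ) ^ (-(k : ℝ) / 2) = ((2 : ℝ) ^ (-(1 / 2) : ℝ)) ^ k := fun k => by
    rw [← Real.rpow_natCast, ← Real.rpow_mul (by norm_num)]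
    congr 1
    ring
  simp_rw [h]
  exact summable_geometric_of_lt_one (by positivity)
    (Real.rpow_lt_one_of_one_lt_of_neg (by norm_num) (by norm_num))

theorem Bbad_eq_limsup : Bbad = limsup Bk atTop := by
  simp [Bbad, limsup_eq_iInf_iSup_of_nat]

theorem measure_Bbad_eq_zero {ν : Measure Conf} (hν : IsBernoulliHalf ν) : ν Bbad = 0 := by
  rw [Bbad_eq_limsup]
  exact measure_limsup_atTop_eq_zero (tsum_measure_Bk_lt_top hν).ne

/-- A zero at a site `j ≤ m` stops the run of ones ending at `m`. -/
theorem runLen_le {ω : Conf} {m j : ℕ} (hj : j ≤ m) (h : ω j = false) :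
    runLen ω m ≤ m - j := by
  by_contra! hlt
  have hspec := Nat.findGreatest_of_ne_zero (m := runLen ω m)
    (P := fun j => 0 < j ∧ ∀ i < j, ω (m - i) = true) rfl (by omega)
  have := hspec.2 (m - j) hlt
  rw [Nat.sub_sub_self hj, h] at this
  simp at this

theorem U_nonneg {ρ : ℝ} (hρ : 0 ≤ ρ) (ω : Conf) (p : ℕ) : 0 ≤ U ρ ω p := by
  unfold U
  split_ifs
  · positivity
  · exact le_rfl

theorem U_le_sqrt_pow {ρ : ℝ} (hρ : ρ ∈ Set.Ioo (0 : ℝ) 1) {ω : Conf} {n : ℕ}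
    (h : runLen ω (2 * (n + 1)) ≤ (n + 2) / 2) : U ρ ω (n + 1) ≤ √ρ ^ n := by
  unfold U
  split_ifs
  · nth_rw 1 [← Real.sq_sqrt hρ.1.le]
    rw [← pow_mul]
    exact pow_le_pow_of_le_one (Real.sqrt_nonneg _)
      (Real.sqrt_le_one.mpr hρ.2.le) (by omega)
  · positivity

theorem H_lt_top {ρ : ℝ} (hρ : ρ ∈ Set.Ioo (0 : ℝ) 1) {ζ ω : Conf} (hω : ω ∉ Bbad)
    (hζ : ∀ i, 1 ≤ i → ζ i = ω i) : H ρ ζ < ⊤ := by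
  simp only [Bbad, Set.mem_iInter, Set.mem_iUnion, not_forall, not_exists] at hω
  obtain ⟨K, hK⟩ := hω
  have hgeom : Summable fun n : ℕ => √ρ ^ n :=
    summable_geometric_of_lt_one (Real.sqrt_nonneg _)
      ((Real.sqrt_lt' one_pos).mpr (by simpa using hρ.2))
  refine Summable.tsum_ofReal_lt_top (Summable.of_norm_bounded_eventually_nat hgeom ?_)
  filter_upwards [eventually_ge_atTop K] with n hn
  rw [Real.norm_of_nonneg (U_nonneg hρ.1.le _ _)]
  apply U_le_sqrt_pow hρ
  have hB := hK (n + 1) (by omega)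
  simp only [Bk, Set.mem_ofPred_eq, not_forall, Bool.not_eq_true] at hB
  obtain ⟨j, hj₁, hj₂, hj⟩ := hB
  have := runLen_le (ω := ζ) hj₂ (by rw [hζ j (by omega), hj])
  omega

/-- `ν(B_k) ≤ 2^{-k/2}`, `Σ_k ν(B_k) < ∞`, hence `ν(B) = 0` by Borel–Cantelli;
moreover `H` is finite on configurations agreeing off site `0` with some `ω ∉ B`, so `H < ∞`
`ν`-almost everywhere. -/
theorem measure_Bk_le_and_H_finite
    (ρ : ℝ) (hρ : ρ ∈ Set.Ioo (0 : ℝ) 1)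
    (ν : Measure Conf) (hν : IsBernoulliHalf ν) :
    (∀ k : ℕ, 1 ≤ k → ν (Bk k) ≤ ENNReal.ofReal ((2 : ℝ) ^ (-(k : ℝ) / 2))) ∧
    (∑' k : ℕ, ν (Bk k)) < ⊤ ∧
    ν Bbad = 0 ∧
    (∀ ζ : Conf, (∃ ω ∉ Bbad, ∀ i, 1 ≤ i → ζ i = ω i) → H ρ ζ < ⊤) ∧
    (∀ ω ∉ Bbad, H ρ ω < ⊤ ∧ H ρ (one ω) < ⊤) ∧
    (∀ᵐ ω ∂ν, H ρ ω < ⊤) := by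
  have hH : ∀ ω ∉ Bbad, H ρ ω < ⊤ := fun ω hω => H_lt_top hρ hω fun _ _ => rfl
  refine ⟨fun k _ => measure_Bk_le hν k, tsum_measure_Bk_lt_top hν, measure_Bbad_eq_zero hν,
    fun ζ ⟨ω, hω, h⟩ => H_lt_top hρ hω h, fun ω hω => ⟨hH ω hω, H_lt_top hρ hω fun i hi => ?_⟩, ?_⟩
  · simp [one, consb, Nat.one_le_iff_ne_zero.mp hi]
  · filter_upwards [measure_eq_zero_iff_ae_notMem.mp (measure_Bbad_eq_zero hν)] with ω hω
    exact hH ω hω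

end WeakGibbsExample
end

section
/- Let ω, ξ ∉ B and let K(ω), K(ξ) be the least indices such that ω ∉ B_k for all k ≥ K(ω) and ξ ∉ B_k for all k ≥ K(ξ), and set K = max(K(ω), K(ξ)). Then for every n > K (with n large enough that ρ^{n/6−3} ≤ 1), Σ_{p = n+1}^{⌊4n/3⌋+1} U_{2p}(1 ω_{[1,2n]} ξ) ≤ n · ρ^{n/6 − 3}; indeed every term in this sum that depends on ω_{[1,2n]} is bounded by ρ^{3n/2 − p − 2} ≤ ρ^{n/6 − 3}. -/
open MeasureTheory Filter Topology
open scoped ENNReal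

namespace WeakGibbsExample

/-- A `0` at site `j` bounds the length of every run of `1`s ending at a later site. -/
lemma runLen_le_sub {ζ : Conf} {j m : ℕ} (hj : ζ j = false) (hjm : j ≤ m) :
    runLen ζ m ≤ m - j := by
  by_contra! h
  have hP : 0 < runLen ζ m ∧ ∀ i < runLen ζ m, ζ (m - i) = true :=
    Nat.findGreatest_of_ne_zero (P := fun j => 0 < j ∧ ∀ i < j, ζ (m - i) = true) rfl
      (Nat.ne_of_gt (Nat.zero_lt_of_lt h))
  have h' := hP.2 _ h
  rw [Nat.sub_sub_self hjm, hj] at h'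
  exact Bool.false_ne_true h'

/-- A `0` at site `j` bounds the later potential terms. -/
lemma U_le_rpow_of_eq_false {ρ : ℝ} (hρ : ρ ∈ Set.Ioo (0 : ℝ) 1) {ζ : Conf} {j p : ℕ}
    (hj : ζ j = false) (hjp : j ≤ 2 * p) {x : ℝ} (hx : x ≤ (j : ℝ) - p) :
    U ρ ζ p ≤ ρ ^ x := by
  unfold U
  split_ifs with h
  · rw [← Real.rpow_natCast]
    refine Real.rpow_le_rpow_of_exponent_ge hρ.1 hρ.2.le (hx.trans ?_)
    rw [Nat.cast_sub h.2.2]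
    have hN : runLen ζ (2 * p) + j ≤ 2 * p := by
      have := runLen_le_sub hj hjp
      omega
    have hN' : (runLen ζ (2 * p) : ℝ) + j ≤ 2 * p := mod_cast hN
    linarith
  · exact (Real.rpow_pos_of_pos hρ.1 x).le

/-- If `ω ∉ B_n`, the potential terms beyond `2n` of a configuration following `ω` up to site
`2n` are bounded, whatever the configuration after `2n`. -/
lemma U_one_glue_le {ρ : ℝ} (hρ : ρ ∈ Set.Ioo (0 : ℝ) 1) {ω : Conf} (ξ : Conf) {n p : ℕ}
    (hn : 0 < n) (hω : ω ∉ Bk n) (hnp : n ≤ p) :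
    U ρ (one (glue ω ξ (2 * n))) p ≤ ρ ^ (3 * (n : ℝ) / 2 - (p : ℝ) - 2) := by
  simp only [Bk, Set.mem_ofPred_eq, not_forall, Bool.not_eq_true] at hω
  obtain ⟨j, hj, hjn, hωj⟩ := hω
  have hζj : one (glue ω ξ (2 * n)) j = false := by
    simp [one, consb, glue, hjn, hωj, show j ≠ 0 by omega]
  refine U_le_rpow_of_eq_false hρ hζj (by omega) ?_
  have h : (3 * n : ℝ) ≤ 2 * j + 1 := mod_cast (show 3 * n ≤ 2 * j + 1 by omega)
  linarith

/-- With `K = max(K(ω), K(ξ))` (the least thresholds beyond which `ω, ξ`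
avoid the bad sets `B_k`), for `n > K` (large enough that `ρ^{n/6-3} ≤ 1`),
`Σ_{p=n+1}^{⌊4n/3⌋+1} U([0,2p], 1 ω_{[1,2n]} ξ) ≤ n ρ^{n/6-3}`; indeed every term of the sum
which depends on `ω_{[1,2n]}` is bounded by `ρ^{3n/2-p-2} ≤ ρ^{n/6-3}`. -/
theorem sum_U_glue_le
    (ρ : ℝ) (hρ : ρ ∈ Set.Ioo (0 : ℝ) 1)
    (ω ξ : Conf) (Kω Kξ : ℕ)
    (hKω : ∀ k, Kω ≤ k → ω ∉ Bk k) (hKξ : ∀ k, Kξ ≤ k → ξ ∉ Bk k)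
    (hKωleast : ∀ K', (∀ k, K' ≤ k → ω ∉ Bk k) → Kω ≤ K')
    (hKξleast : ∀ K', (∀ k, K' ≤ k → ξ ∉ Bk k) → Kξ ≤ K')
    (n : ℕ) (hn : max Kω Kξ < n) (hρn : ρ ^ ((n : ℝ) / 6 - 3) ≤ 1) :
    (∑ p ∈ Finset.Icc (n + 1) (4 * n / 3 + 1), U ρ (one (glue ω ξ (2 * n))) p) ≤
        (n : ℝ) * ρ ^ ((n : ℝ) / 6 - 3) ∧
    ∀ p ∈ Finset.Icc (n + 1) (4 * n / 3 + 1),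
      ((∃ ω' : Conf, U ρ (one (glue ω' ξ (2 * n))) p ≠ U ρ (one (glue ω ξ (2 * n))) p) →
        U ρ (one (glue ω ξ (2 * n))) p ≤ ρ ^ (3 * (n : ℝ) / 2 - (p : ℝ) - 2)) ∧
      ρ ^ (3 * (n : ℝ) / 2 - (p : ℝ) - 2) ≤ ρ ^ ((n : ℝ) / 6 - 3) := by
  have hn0 : 0 < n := Nat.zero_lt_of_lt hn
  have hω : ω ∉ Bk n := hKω n (by omega)
  have hterm : ∀ p ∈ Finset.Icc (n + 1) (4 * n / 3 + 1),
      U ρ (one (glue ω ξ (2 * n))) p ≤ ρ ^ (3 * (n : ℝ) / 2 - (p : ℝ) - 2) := fun p hp =>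
    U_one_glue_le hρ ξ hn0 hω (by have := (Finset.mem_Icc.mp hp).1; omega)
  have hexp : ∀ p ∈ Finset.Icc (n + 1) (4 * n / 3 + 1),
      ρ ^ (3 * (n : ℝ) / 2 - (p : ℝ) - 2) ≤ ρ ^ ((n : ℝ) / 6 - 3) := fun p hp => by
    refine Real.rpow_le_rpow_of_exponent_ge hρ.1 hρ.2.le ?_
    have h : (3 * p : ℝ) ≤ 4 * n + 3 :=
      mod_cast (show 3 * p ≤ 4 * n + 3 by have := (Finset.mem_Icc.mp hp).2; omega)
    linarith
  refine ⟨?_, fun p hp => ⟨fun _ => hterm p hp, hexp p hp⟩⟩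
  have hcard : (Finset.Icc (n + 1) (4 * n / 3 + 1)).card ≤ n := by
    rw [Nat.card_Icc]
    omega
  calc
    _ ≤ (Finset.Icc (n + 1) (4 * n / 3 + 1)).card • ρ ^ ((n : ℝ) / 6 - 3) :=
      Finset.sum_le_card_nsmul _ _ _ fun p hp => (hterm p hp).trans (hexp p hp)
    _ ≤ (n : ℝ) * ρ ^ ((n : ℝ) / 6 - 3) := by
      rw [nsmul_eq_mul]
      have := (Real.rpow_pos_of_pos hρ.1 ((n : ℝ) / 6 - 3)).le
      gcongr

end WeakGibbsExample
end

section
/- Let μ be the measure on Ω with density dμ/dν = exp(−H). Let ω ∉ B (so H(1ω) < ∞) and let 0 < ε < (1/4)·exp(−H(1ω_{[1,∞)})). If ν([ω_{[1,n]}] ∩ A^ω_{ε,n}) / ν([ω_{[1,n]}]) → 0 as n → ∞, then μ([ω_{[1,n]}] ∩ A^ω_{ε,n}) / μ([ω_{[1,n]}]) → 0 as n → ∞. -/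
open MeasureTheory Filter Topology
open scoped ENNReal

namespace WeakGibbsExample

lemma expH_le_one (ρ : ℝ) (ζ : Conf) : expH ρ ζ ≤ 1 := by
  unfold expH
  split_ifs
  · exact zero_le_one
  · rw [ENNReal.ofReal_le_one, Real.exp_le_one_iff]
    exact neg_nonpos.2 ENNReal.toReal_nonneg

lemma expH_eq_one_of_zero_eq_false (ρ : ℝ) {ζ : Conf} (hζ : ζ 0 = false) : expH ρ ζ = 1 := by
  have hH : H ρ ζ = 0 := by simp [H, U, hζ]
  simp [expH, hH]

/-- The density `exp(-H)` is at most `1`. -/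
lemma withDensity_expH_le (ρ : ℝ) (ν : Measure Conf) : ν.withDensity (expH ρ) ≤ ν :=
  (withDensity_mono (ae_of_all _ (expH_le_one ρ))).trans_eq withDensity_one

lemma cylTail_eq (ω : Conf) (n : ℕ) :
    cylTail ω n = {ζ | ∀ i ∈ Finset.Icc 1 n, ζ i = ω i} := by
  ext ζ
  simp [cylTail]

lemma IsBernoulliHalf.measure_cylTail {ν : Measure Conf} (hν : IsBernoulliHalf ν)
    (ω : Conf) (n : ℕ) : ν (cylTail ω n) = (2 : ℝ≥0∞)⁻¹ ^ n := by
  rw [cylTail_eq, hν.2]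
  simp

lemma measurableSet_eqOn_finset (s : Finset ℕ) (f : Conf) :
    MeasurableSet {ζ : Conf | ∀ i ∈ s, ζ i = f i} := by
  have : {ζ : Conf | ∀ i ∈ s, ζ i = f i} = ⋂ i ∈ s, (fun ζ : Conf => ζ i) ⁻¹' {f i} := by
    ext ζ
    simp
  rw [this]
  exact Finset.measurableSet_biInter s fun i _ =>
    measurable_pi_apply i (measurableSet_singleton _)

/-- Half of a cylinder on `[1,n]` has symbol `0` at the origin, where the density is `1`. -/
lemma IsBernoulliHalf.half_measure_cylTail_le {ν : Measure Conf} (hν : IsBernoulliHalf ν)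
    (ρ : ℝ) (ω : Conf) (n : ℕ) :
    2⁻¹ * ν (cylTail ω n) ≤ ν.withDensity (expH ρ) (cylTail ω n) := by
  set D : Set Conf := {ζ | ∀ i ∈ Finset.range (n + 1), ζ i = consb false ω i} with hD
  have hDm : MeasurableSet D := measurableSet_eqOn_finset _ _
  have hDsub : D ⊆ cylTail ω n := by
    intro ζ hζ i hi hin
    have h := hζ i (Finset.mem_range.2 (by omega))
    rwa [consb, if_neg (by omega)] at h
  calc 2⁻¹ * ν (cylTail ω n) = ν D := by
        rw [hν.measure_cylTail, hD, hν.2, Finset.card_range, pow_succ']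
    _ = ∫⁻ _ in D, 1 ∂ν := by simp
    _ = ∫⁻ ζ in D, expH ρ ζ ∂ν := setLIntegral_congr_fun hDm fun ζ hζ =>
        (expH_eq_one_of_zero_eq_false ρ (hζ 0 (by simp))).symm
    _ = ν.withDensity (expH ρ) D := (withDensity_apply _ hDm).symm
    _ ≤ ν.withDensity (expH ρ) (cylTail ω n) := measure_mono hDsub

/-- For `μ = exp(-H) dν`, `ω ∉ B` and
`0 < ε < (1/4) exp(-H(1ω))`, the `ν`-conditional probabilities of the bad sets tending to `0`
implies the same for the `μ`-conditional probabilities. -/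
theorem mu_ratio_tendsto_of_nu_ratio_tendsto
    (ρ : ℝ) (hρ : ρ ∈ Set.Ioo (0 : ℝ) 1)
    (ν : Measure Conf) (hν : IsBernoulliHalf ν)
    (μ : Measure Conf) (hμ : μ = ν.withDensity (expH ρ))
    (ω : Conf) (hω : ω ∉ Bbad) (ε : ℝ) (hε0 : 0 < ε)
    (hε : ε < (1 / 4) * Real.exp (-(H ρ (one ω)).toReal))
    (hνconv : Tendsto
      (fun n : ℕ => ν (cylTail ω n ∩ Abad ρ ω ε n) / ν (cylTail ω n)) atTop (nhds 0)) :
    Tendsto (fun n : ℕ => μ (cylTail ω n ∩ Abad ρ ω ε n) / μ (cylTail ω n)) atTop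
      (nhds 0) := by
  have hbound : ∀ n, μ (cylTail ω n ∩ Abad ρ ω ε n) / μ (cylTail ω n) ≤
      2 * (ν (cylTail ω n ∩ Abad ρ ω ε n) / ν (cylTail ω n)) := by
    intro n
    subst hμ
    calc _ ≤ ν (cylTail ω n ∩ Abad ρ ω ε n) / (2⁻¹ * ν (cylTail ω n)) :=
          ENNReal.div_le_div (withDensity_expH_le ρ ν _) (hν.half_measure_cylTail_le ρ ω n)
      _ = _ := by
          rw [div_eq_mul_inv, div_eq_mul_inv, ENNReal.mul_inv (by simp) (by simp), inv_inv]
          ring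
  have hlim := ENNReal.Tendsto.const_mul hνconv (a := 2) (Or.inr (by simp))
  rw [mul_zero] at hlim
  exact tendsto_of_tendsto_of_tendsto_of_le_of_le tendsto_const_nhds hlim
    (fun _ => zero_le) hbound

end WeakGibbsExample
end

section
/- For every n ≥ 0, the preimage under φ of the cylinder { y : y_0 = 0 and y_1 = ⋯ = y_n = 2 } is contained in { (x,w) : x_i = 2 and w_i = −1 for 0 ≤ i ≤ n, and w_{−1} = 1 }. Consequently ν({ y : y_0 = 0, y_1 = ⋯ = y_n = 2 }) ≤ (p_2 ε)^{n+1}. -/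
open MeasureTheory Filter Topology
open scoped ENNReal

namespace BitShift

/-- Bi-infinite integer sequences. -/
abbrev Seq := ℤ → ℤ

/-- The bit-shift channel map `φ(x,w)_i = x_i + w_i - w_{i-1}`. -/
def phi (x w : Seq) : Seq := fun i => x i + w i - w (i - 1)

/-- `x` is a legal source sequence: `x_i ∈ {2,…,k}` for all `i`. -/
def InX (k : ℤ) (x : Seq) : Prop := ∀ i, 2 ≤ x i ∧ x i ≤ k

/-- `w` is a legal jitter sequence: `w_i ∈ {-1,0,1}` for all `i`. -/
def InW (w : Seq) : Prop := ∀ i, w i = -1 ∨ w i = 0 ∨ w i = 1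

/-- `m` is the Bernoulli product measure on `ℤ^ℤ` with one-site weights `wt`. -/
def IsBernoulliProd (m : Measure Seq) (wt : ℤ → ℝ≥0∞) : Prop :=
  ∀ (s : Finset ℤ) (f : ℤ → ℤ), m {z | ∀ i ∈ s, z i = f i} = ∏ i ∈ s, wt (f i)

/-- One-site weights of the source measure `μ`. -/
def srcWt (k : ℤ) (p : ℤ → ℝ≥0∞) : ℤ → ℝ≥0∞ :=
  fun j => if 2 ≤ j ∧ j ≤ k then p j else 0

/-- One-site weights of the jitter measure `π`. -/
noncomputable def jitWt (ε : ℝ≥0∞) : ℤ → ℝ≥0∞ :=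
  fun j => if j = 1 ∨ j = -1 then ε else if j = 0 then 1 - 2 * ε else 0


/-- Deterministic part: a zero followed by a block of twos forces `x` and `w` on that block. -/
lemma eq_of_phi_zero_two {k : ℤ} {x w : Seq} (hx : InX k x) (hw : InW w) (n : ℕ)
    (h0 : phi x w 0 = 0) (h2 : ∀ i : ℤ, 1 ≤ i → i ≤ (n : ℤ) → phi x w i = 2) :
    (∀ i : ℤ, 0 ≤ i → i ≤ (n : ℤ) → x i = 2 ∧ w i = -1) ∧ w (-1) = 1 := by
  have base : (x 0 = 2 ∧ w 0 = -1) ∧ w (-1) = 1 := by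
    have h : x 0 + w 0 - w (-1) = 0 := by simpa [phi] using h0
    have h₁ := hx 0
    have h₂ := hw 0
    have h₃ := hw (-1)
    omega
  refine ⟨fun i hi => ?_, base.2⟩
  induction i, hi using Int.leInduction with
  | base => exact fun _ => base.1
  | succ i hi ih =>
    intro hin
    have hprev := ih (by omega)
    have h : x (i + 1) + w (i + 1) - w i = 2 := by
      simpa [phi] using h2 (i + 1) (by omega) hin
    have h₁ := hx (i + 1)
    have h₂ := hw (i + 1)
    omega

/-- Under a Bernoulli product measure, almost surely every symbol has nonzero weight. -/
lemma IsBernoulliProd.ae_wt_ne_zero {m : Measure Seq} {wt : ℤ → ℝ≥0∞}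
    (hm : IsBernoulliProd m wt) : ∀ᵐ z ∂m, ∀ i, wt (z i) ≠ 0 := by
  refine ae_all_iff.2 fun i => ?_
  have h : ∀ᵐ z ∂m, ∀ j, wt j = 0 → z i ≠ j := by
    refine ae_all_iff.2 fun j => ?_
    by_cases hj : wt j = 0
    · have hcyl := hm {i} fun _ => j
      simp only [Finset.mem_singleton, forall_eq, Finset.prod_singleton, hj] at hcyl
      simpa [ae_iff, hj] using hcyl
    · simp [hj]
  filter_upwards [h] with z hz h0
  exact hz _ h0 rfl

/-- Under the source measure, almost every sequence is legal. -/
lemma IsBernoulliProd.ae_inX {m : Measure Seq} {k : ℤ} {p : ℤ → ℝ≥0∞}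
    (hm : IsBernoulliProd m (srcWt k p)) : ∀ᵐ x ∂m, InX k x := by
  filter_upwards [hm.ae_wt_ne_zero] with x hx i
  by_contra h
  exact hx i (by simp only [srcWt, if_neg h])

/-- Under the jitter measure, almost every sequence is legal. -/
lemma IsBernoulliProd.ae_inW {m : Measure Seq} {ε : ℝ≥0∞}
    (hm : IsBernoulliProd m (jitWt ε)) : ∀ᵐ w ∂m, InW w := by
  filter_upwards [hm.ae_wt_ne_zero] with w hw i
  by_contra h
  exact hw i (by rw [jitWt, if_neg (by omega), if_neg (by omega)])

/-- The measure of a constant block of length `n + 1`. -/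
lemma IsBernoulliProd.measure_const_block {m : Measure Seq} {wt : ℤ → ℝ≥0∞}
    (hm : IsBernoulliProd m wt) (n : ℕ) (j : ℤ) :
    m {z | ∀ i ∈ Finset.Icc (0 : ℤ) n, z i = j} = wt j ^ (n + 1) := by
  rw [hm (Finset.Icc (0 : ℤ) n) fun _ => j, Finset.prod_const, Int.card_Icc]
  congr 1

lemma measurable_phi : Measurable fun xw : Seq × Seq => phi xw.1 xw.2 := by
  unfold phi
  fun_prop

lemma measurableSet_zero_two_cylinder (n : ℕ) :
    MeasurableSet {y : Seq | y 0 = 0 ∧ ∀ i : ℤ, 1 ≤ i → i ≤ (n : ℤ) → y i = 2} := by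
  have h (i j : ℤ) : MeasurableSet {y : Seq | y i = j} :=
    (measurable_pi_apply (X := fun _ : ℤ => ℤ) i) (measurableSet_singleton j)
  simp only [Set.ofPred_and, Set.ofPred_forall]
  exact (h 0 0).inter <| .iInter fun i => .iInter fun _ => .iInter fun _ => h i 2

/-- The preimage under `φ` of the cylinder `{y_0 = 0, y_1 = ⋯ = y_n = 2}`
is contained in `{x_i = 2, w_i = -1 for 0 ≤ i ≤ n, and w_{-1} = 1}`; consequently
`ν([0,2,…,2]) ≤ (p_2 ε)^{n+1}`. -/
theorem preimage_zero_two_cylinder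
    (k : ℤ) (hk : 3 ≤ k) (p : ℤ → ℝ≥0∞)
    (hp : ∀ j, 2 ≤ j → j ≤ k → 0 < p j)
    (hpsum : ∑ j ∈ Finset.Icc 2 k, p j = 1)
    (ε : ℝ≥0∞) (hε0 : 0 < ε) (hε : ε < 1 / 2)
    (μ π : Measure Seq) [IsProbabilityMeasure μ] [IsProbabilityMeasure π]
    (hμ : IsBernoulliProd μ (srcWt k p)) (hπ : IsBernoulliProd π (jitWt ε))
    (ν : Measure Seq) (hν : ν = (μ.prod π).map fun xw => phi xw.1 xw.2)
    (n : ℕ) :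
    (∀ x w : Seq, InX k x → InW w →
      (phi x w 0 = 0 ∧ ∀ i : ℤ, 1 ≤ i → i ≤ (n : ℤ) → phi x w i = 2) →
      (∀ i : ℤ, 0 ≤ i → i ≤ (n : ℤ) → x i = 2 ∧ w i = -1) ∧ w (-1) = 1) ∧
    ν {y | y 0 = 0 ∧ ∀ i : ℤ, 1 ≤ i → i ≤ (n : ℤ) → y i = 2} ≤ (p 2 * ε) ^ (n + 1) := by
  refine ⟨fun x w hx hw h => eq_of_phi_zero_two hx hw n h.1 h.2, ?_⟩
  rw [hν, Measure.map_apply measurable_phi (measurableSet_zero_two_cylinder n)]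
  calc
    _ ≤ (μ.prod π) ({x | ∀ i ∈ Finset.Icc (0 : ℤ) n, x i = 2} ×ˢ
          {w | ∀ i ∈ Finset.Icc (0 : ℤ) n, w i = -1}) := by
      refine measure_mono_ae ?_
      filter_upwards [Measure.quasiMeasurePreserving_fst.ae hμ.ae_inX,
        Measure.quasiMeasurePreserving_snd.ae hπ.ae_inW] with xw hx hw hy
      have h := (eq_of_phi_zero_two hx hw n hy.1 hy.2).1
      exact ⟨fun i hi => (h i (Finset.mem_Icc.1 hi).1 (Finset.mem_Icc.1 hi).2).1,
        fun i hi => (h i (Finset.mem_Icc.1 hi).1 (Finset.mem_Icc.1 hi).2).2⟩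
    _ = (p 2 * ε) ^ (n + 1) := by
      have h2 : srcWt k p 2 = p 2 := if_pos ⟨le_rfl, by omega⟩
      have h1 : jitWt ε (-1) = ε := if_pos (Or.inr rfl)
      rw [Measure.prod_prod, hμ.measure_const_block, hπ.measure_const_block, h2, h1, mul_pow]

end BitShift
end

section
/- For every n ≥ 1, ν({ y : y_1 = ⋯ = y_n = 2 }) ≥ Σ_{j=1}^{n} p_2^{n−1} p_3 (1 − 2ε)^{j} ε^{n−j+1}. In particular, if 0 < ε < 1/3, then ν({ y : y_1 = ⋯ = y_n = 2 }) ≥ n · p_2^{n−1} p_3 · ε^{n+1}. -/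
open MeasureTheory Filter Topology
open scoped ENNReal

namespace BitShift

/-- The source word that is `3` at `j` and `2` elsewhere. -/
def srcWord (j : ℤ) : Seq := fun i => if i = j then 3 else 2

/-- The jitter word that drops from `0` to `-1` at position `j`. -/
def jitWord (j : ℤ) : Seq := fun i => if i < j then 0 else -1

/-- Pairs that agree with `srcWord j` on `[1, n]` and with `jitWord j` on `[0, n]`. -/
def dropEvent (n : ℕ) (j : ℤ) : Set (Seq × Seq) :=
  {x | ∀ i ∈ Finset.Icc (1 : ℤ) n, x i = srcWord j i} ×ˢ
    {w | ∀ i ∈ Finset.Icc (0 : ℤ) n, w i = jitWord j i}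

lemma measurableSet_forall_finset_eq (s : Finset ℤ) (f : Seq) :
    MeasurableSet {z : Seq | ∀ i ∈ s, z i = f i} := by
  simp only [Set.ofPred_forall]
  exact s.measurableSet_biInter fun i _ => measurableSet_eq_fun (measurable_pi_apply i) measurable_const

lemma measurableSet_dropEvent (n : ℕ) (j : ℤ) : MeasurableSet (dropEvent n j) :=
  (measurableSet_forall_finset_eq _ _).prod (measurableSet_forall_finset_eq _ _)

lemma phi_eq_two_of_mem_dropEvent {n : ℕ} {j : ℤ} {xw : Seq × Seq} (h : xw ∈ dropEvent n j)
    {i : ℤ} (h1 : 1 ≤ i) (hn : i ≤ n) : phi xw.1 xw.2 i = 2 := by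
  obtain ⟨hx, hw⟩ := h
  have ex := hx i (Finset.mem_Icc.2 ⟨h1, hn⟩)
  have ew := hw i (Finset.mem_Icc.2 ⟨by lia, hn⟩)
  have ew' := hw (i - 1) (Finset.mem_Icc.2 ⟨by lia, by lia⟩)
  simp only [phi, ex, ew, ew', srcWord, jitWord]
  split_ifs <;> lia

lemma disjoint_dropEvent {n : ℕ} {j l : ℤ} (hj1 : 1 ≤ j) (hjn : j ≤ n) (hne : j ≠ l) :
    Disjoint (dropEvent n j) (dropEvent n l) := by
  refine Set.disjoint_left.2 fun xw hj hl => ?_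
  have hmem : j ∈ Finset.Icc (1 : ℤ) n := Finset.mem_Icc.2 ⟨hj1, hjn⟩
  have h := (hj.1 j hmem).symm.trans (hl.1 j hmem)
  simp [srcWord, hne] at h

lemma prod_srcWt_srcWord {k : ℤ} (hk : 3 ≤ k) (p : ℤ → ℝ≥0∞) {n j : ℕ}
    (hj : j ∈ Finset.Icc 1 n) :
    ∏ i ∈ Finset.Icc (1 : ℤ) n, srcWt k p (srcWord j i) = p 2 ^ (n - 1) * p 3 := by
  rw [Finset.mem_Icc] at hj
  have hmem : (j : ℤ) ∈ Finset.Icc (1 : ℤ) n := by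
    rw [Finset.mem_Icc]
    lia
  have h2 : ∀ i ∈ (Finset.Icc (1 : ℤ) n).erase j, srcWt k p (srcWord j i) = p 2 := by
    intro i hi
    have : 2 ≤ k := by lia
    simp [srcWt, srcWord, Finset.ne_of_mem_erase hi, this]
  rw [← Finset.prod_erase_mul _ _ hmem, Finset.prod_congr rfl h2, Finset.prod_const,
    Finset.card_erase_of_mem hmem]
  simp [srcWt, srcWord, hk]

lemma prod_jitWt_jitWord (ε : ℝ≥0∞) {n j : ℕ} (hj : j ∈ Finset.Icc 1 n) :
    ∏ i ∈ Finset.Icc (0 : ℤ) n, jitWt ε (jitWord j i) = (1 - 2 * ε) ^ j * ε ^ (n - j + 1) := by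
  rw [Finset.mem_Icc] at hj
  have h (i : ℤ) : jitWt ε (jitWord j i) = if i < (j : ℤ) then 1 - 2 * ε else ε := by
    by_cases hi : i < (j : ℤ) <;> simp [jitWt, jitWord, hi]
  have hlt : (Finset.Icc (0 : ℤ) n).filter (· < (j : ℤ)) = Finset.Ico (0 : ℤ) j := by
    ext i
    simp only [Finset.mem_filter, Finset.mem_Icc, Finset.mem_Ico]
    lia
  have hge : (Finset.Icc (0 : ℤ) n).filter (¬ · < (j : ℤ)) = Finset.Icc (j : ℤ) n := by
    ext i
    simp only [Finset.mem_filter, Finset.mem_Icc]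
    lia
  simp only [h]
  rw [Finset.prod_ite, Finset.prod_const, Finset.prod_const, hlt, hge, Int.card_Ico, Int.card_Icc]
  congr 2
  lia

lemma measure_dropEvent {k : ℤ} (hk : 3 ≤ k) {p : ℤ → ℝ≥0∞} {ε : ℝ≥0∞} {μ π : Measure Seq}
    [SFinite π] (hμ : IsBernoulliProd μ (srcWt k p)) (hπ : IsBernoulliProd π (jitWt ε))
    {n j : ℕ} (hj : j ∈ Finset.Icc 1 n) :
    μ.prod π (dropEvent n j) =
      p 2 ^ (n - 1) * p 3 * (1 - 2 * ε) ^ j * ε ^ (n - j + 1) := by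
  rw [dropEvent, Measure.prod_prod, hμ, hπ, prod_srcWt_srcWord hk p hj, prod_jitWt_jitWord ε hj,
    ← mul_assoc]

lemma le_one_sub_two_mul {ε : ℝ≥0∞} (hε : ε < 1 / 3) : ε ≤ 1 - 2 * ε := by
  refine ENNReal.le_sub_of_add_le_right (by finiteness) ?_
  calc ε + 2 * ε = ε * 3 := by ring
    _ ≤ 1 := ENNReal.mul_le_of_le_div hε.le

/-- Lower bound on the measure of the all-two cylinder:
`ν([2,…,2]) ≥ Σ_{j=1}^n p_2^{n-1} p_3 (1-2ε)^j ε^{n-j+1}`, and for `ε < 1/3`,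
`ν([2,…,2]) ≥ n p_2^{n-1} p_3 ε^{n+1}`. -/
theorem measure_two_cylinder_ge
    (k : ℤ) (hk : 3 ≤ k) (p : ℤ → ℝ≥0∞)
    (hp : ∀ j, 2 ≤ j → j ≤ k → 0 < p j)
    (hpsum : ∑ j ∈ Finset.Icc 2 k, p j = 1)
    (ε : ℝ≥0∞) (hε0 : 0 < ε) (hε : ε < 1 / 2)
    (μ π : Measure Seq) [IsProbabilityMeasure μ] [IsProbabilityMeasure π]
    (hμ : IsBernoulliProd μ (srcWt k p)) (hπ : IsBernoulliProd π (jitWt ε))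
    (ν : Measure Seq) (hν : ν = (μ.prod π).map fun xw => phi xw.1 xw.2)
    (n : ℕ) (hn : 1 ≤ n) :
    ν {y | ∀ i : ℤ, 1 ≤ i → i ≤ (n : ℤ) → y i = 2} ≥
      ∑ j ∈ Finset.Icc 1 n, p 2 ^ (n - 1) * p 3 * (1 - 2 * ε) ^ j * ε ^ (n - j + 1) ∧
    (ε < 1 / 3 →
      ν {y | ∀ i : ℤ, 1 ≤ i → i ≤ (n : ℤ) → y i = 2} ≥
        (n : ℝ≥0∞) * p 2 ^ (n - 1) * p 3 * ε ^ (n + 1)) := by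
  have hsum : ∑ j ∈ Finset.Icc 1 n, p 2 ^ (n - 1) * p 3 * (1 - 2 * ε) ^ j * ε ^ (n - j + 1) ≤
      ν {y | ∀ i : ℤ, 1 ≤ i → i ≤ (n : ℤ) → y i = 2} := by
    have hdisj : (Finset.Icc 1 n : Set ℕ).PairwiseDisjoint fun j : ℕ => dropEvent n j := by
      intro j hj l _ hne
      rw [Finset.mem_coe, Finset.mem_Icc] at hj
      exact disjoint_dropEvent (by lia) (by lia) (by lia)
    rw [← Finset.sum_congr rfl fun j hj => measure_dropEvent hk hμ hπ hj,
      ← measure_biUnion_finset hdisj fun j _ => measurableSet_dropEvent n j, hν]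
    refine le_trans (measure_mono ?_) (Measure.le_map_apply measurable_phi.aemeasurable _)
    exact Set.iUnion₂_subset fun j _ xw hxw i h1 hn => phi_eq_two_of_mem_dropEvent hxw h1 hn
  refine ⟨hsum, fun hε3 => le_trans ?_ hsum⟩
  calc (n : ℝ≥0∞) * p 2 ^ (n - 1) * p 3 * ε ^ (n + 1)
      = ∑ j ∈ Finset.Icc 1 n, p 2 ^ (n - 1) * p 3 * ε ^ j * ε ^ (n - j + 1) := by
        rw [Finset.sum_congr rfl (g := fun _ => p 2 ^ (n - 1) * p 3 * ε ^ (n + 1))]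
        · simp [mul_assoc]
        · intro j hj
          rw [Finset.mem_Icc] at hj
          rw [mul_assoc, ← pow_add]
          congr 2
          lia
    _ ≤ _ := by
        gcongr
        exact le_one_sub_two_mul hε3

end BitShift
end

section
/- Assume 0 < ε < 1/3. Then ν does not have the Bowen–Gibbs property: there exist no bounded continuous function ψ : Y → ℝ and constants P ∈ ℝ and C > 1 such that for every y ∈ Y and every n ≥ 0, C^{−1} ≤ ν([y_0, y_1, …, y_n]) / exp( Σ_{m=0}^{n} ψ(σ^m y) − (n+1) P ) ≤ C, where σ : Y → Y is the left shift and [y_0,…,y_n] = { z ∈ Y : z_i = y_i for 0 ≤ i ≤ n }. In particular, ν is not a Gibbs measure for any Hölder continuous potential on the sofic shift Y. -/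
open MeasureTheory Filter Topology
open scoped ENNReal

namespace BitShift

/-- The sofic shift `Y = φ(X × W)`. -/
def soficY (k : ℤ) : Set Seq :=
  {y | ∃ x w : Seq, InX k x ∧ InW w ∧ y = phi x w}

/-- The left shift `σ` on sequences. -/
def shiftL (y : Seq) : Seq := fun i => y (i + 1)

lemma IsBernoulliProd.measure_const {m : Measure Seq} {wt : ℤ → ℝ≥0∞}
    (hm : IsBernoulliProd m wt) (s : Finset ℤ) (j : ℤ) :
    m {z | ∀ i ∈ s, z i = j} = wt j ^ s.card := by
  simpa using hm s fun _ => j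

lemma shiftL_mem_soficY {k : ℤ} {y : Seq} (hy : y ∈ soficY k) : shiftL y ∈ soficY k := by
  obtain ⟨x, w, hx, hw, rfl⟩ := hy
  refine ⟨shiftL x, shiftL w, fun i => hx _, fun i => hw _, ?_⟩
  funext i
  simp [shiftL, phi]

lemma shiftL_iterate_mem_soficY {k : ℤ} {y : Seq} (hy : y ∈ soficY k) (m : ℕ) :
    shiftL^[m] y ∈ soficY k := by
  induction m with
  | zero => exact hy
  | succ m ih => rw [Function.iterate_succ_apply']; exact shiftL_mem_soficY ih

/-- The constant sequence `k` with a single entry `k + 2` at position `N`. -/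
def spike (k N : ℤ) : Seq := fun i => if i = N then k + 2 else k

lemma spike_mem_soficY {k : ℤ} (hk : 2 ≤ k) (N : ℤ) : spike k N ∈ soficY k := by
  refine ⟨fun _ => k, fun i => if i < N then -1 else 1, fun _ => ⟨hk, le_rfl⟩, fun i => ?_, ?_⟩
  · by_cases h : i < N <;> simp [h]
  · funext i
    simp only [spike, phi]
    split_ifs <;> omega

/-- A block `k, …, k, k + 2` in the output forces the jitter to be `-1` until the last symbol. -/
lemma eq_of_phi_eq_spike {k : ℤ} {x w : Seq} (hx : InX k x) (hw : InW w) (n : ℕ)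
    (h : ∀ i : ℤ, 0 ≤ i → i ≤ n → phi x w i = spike k n i) :
    (∀ i ∈ Finset.Icc (0 : ℤ) n, x i = k) ∧ ∀ i ∈ Finset.Icc (-1 : ℤ) (n - 1), w i = -1 := by
  have hlast := h n (by positivity) le_rfl
  simp only [phi, spike, if_true] at hlast
  have hxn := hx n
  have hwn := hw n
  have hwn' := hw (n - 1)
  have back : ∀ j : ℕ, j ≤ n → w (n - 1 - j) = -1 := by
    intro j
    induction j with
    | zero => intro _; simp only [Nat.cast_zero, sub_zero]; omega
    | succ j ih =>
      intro hj
      have h1 := ih (by omega)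
      have h2 := h (n - 1 - j) (by omega) (by omega)
      simp only [phi, spike] at h2
      rw [if_neg (by omega), h1] at h2
      have h3 := hx (n - 1 - j)
      have h4 := hw (n - 1 - j - 1)
      rw [show (n : ℤ) - 1 - (j + 1 : ℕ) = n - 1 - j - 1 by push_cast; ring]
      omega
  have hwall : ∀ i ∈ Finset.Icc (-1 : ℤ) (n - 1), w i = -1 := by
    intro i hi
    rw [Finset.mem_Icc] at hi
    have := back (n - 1 - i).toNat (by omega)
    rwa [show (n : ℤ) - 1 - ((n - 1 - i).toNat : ℤ) = i by omega] at this
  refine ⟨fun i hi => ?_, hwall⟩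
  rw [Finset.mem_Icc] at hi
  by_cases hin : i = n
  · subst hin; omega
  · have h1 := hwall i (by rw [Finset.mem_Icc]; omega)
    have h2 := hwall (i - 1) (by rw [Finset.mem_Icc]; omega)
    have h3 := h i hi.1 hi.2
    simp only [phi, spike, if_neg hin, h1, h2] at h3
    omega

lemma measure_spike_le {k : ℤ} {p : ℤ → ℝ≥0∞} {ε : ℝ≥0∞} {μ π : Measure Seq}
    [IsProbabilityMeasure μ] [IsProbabilityMeasure π] (hk : 2 ≤ k)
    (hμ : IsBernoulliProd μ (srcWt k p)) (hπ : IsBernoulliProd π (jitWt ε)) (n : ℕ) :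
    ((μ.prod π).map fun xw => phi xw.1 xw.2)
      {z | z ∈ soficY k ∧ ∀ i : ℤ, 0 ≤ i → i ≤ (n : ℤ) → z i = spike k n i} ≤
      p k ^ (n + 1) * ε ^ (n + 1) := by
  set A : Set Seq := {z | ∀ i : ℤ, 0 ≤ i → i ≤ (n : ℤ) → z i = spike k n i}
  have hA : MeasurableSet A := by
    simp only [A, Set.ofPred_forall]
    refine .iInter fun i => .iInter fun _ => .iInter fun _ => ?_
    exact measurableSet_eq_fun (measurable_pi_apply i) measurable_const
  have hX : ∀ᵐ q ∂μ.prod π, InX k q.1 := Measure.quasiMeasurePreserving_fst.ae hμ.ae_inX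
  have hW : ∀ᵐ q ∂μ.prod π, InW q.2 := Measure.quasiMeasurePreserving_snd.ae hπ.ae_inW
  calc
    _ ≤ ((μ.prod π).map fun xw => phi xw.1 xw.2) A := measure_mono fun z hz => hz.2
    _ = μ.prod π ((fun xw : Seq × Seq => phi xw.1 xw.2) ⁻¹' A) :=
      Measure.map_apply measurable_phi hA
    _ ≤ μ.prod π ({x | ∀ i ∈ Finset.Icc (0 : ℤ) n, x i = k} ×ˢ
          {w | ∀ i ∈ Finset.Icc (-1 : ℤ) (n - 1), w i = -1}) := by
      refine measure_mono_ae ?_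
      filter_upwards [hX, hW] with q hq1 hq2 hq
      exact eq_of_phi_eq_spike hq1 hq2 n hq
    _ = p k ^ (n + 1) * ε ^ (n + 1) := by
      rw [Measure.prod_prod, hμ.measure_const, hπ.measure_const]
      simp only [Int.card_Icc, srcWt, jitWt, hk, le_refl, and_self, or_true, if_true]
      congr 2
      omega

lemma le_measure_const {k : ℤ} {p : ℤ → ℝ≥0∞} {ε : ℝ≥0∞} {μ π : Measure Seq}
    [IsProbabilityMeasure μ] [IsProbabilityMeasure π] (hk : 2 ≤ k)
    (hμ : IsBernoulliProd μ (srcWt k p)) (hπ : IsBernoulliProd π (jitWt ε)) (n : ℕ) :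
    p k ^ (n + 1) * (1 - 2 * ε) ^ (n + 2) ≤
      ((μ.prod π).map fun xw => phi xw.1 xw.2)
        {z | z ∈ soficY k ∧ ∀ i : ℤ, 0 ≤ i → i ≤ (n : ℤ) → z i = k} := by
  have hX : ∀ᵐ q ∂μ.prod π, InX k q.1 := Measure.quasiMeasurePreserving_fst.ae hμ.ae_inX
  have hW : ∀ᵐ q ∂μ.prod π, InW q.2 := Measure.quasiMeasurePreserving_snd.ae hπ.ae_inW
  calc
    _ = μ.prod π ({x | ∀ i ∈ Finset.Icc (0 : ℤ) n, x i = k} ×ˢ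
          {w | ∀ i ∈ Finset.Icc (-1 : ℤ) n, w i = 0}) := by
      rw [Measure.prod_prod, hμ.measure_const, hπ.measure_const]
      simp only [Int.card_Icc, srcWt, jitWt, hk, le_refl, and_self, if_true]
      norm_num
      congr 2
    _ ≤ μ.prod π ((fun xw : Seq × Seq => phi xw.1 xw.2) ⁻¹' _) := by
      refine measure_mono_ae ?_
      filter_upwards [hX, hW] with q hq1 hq2 hq
      refine ⟨⟨q.1, q.2, hq1, hq2, rfl⟩, fun i hi0 hin => ?_⟩
      have h1 := hq.1 i (by rw [Finset.mem_Icc]; omega)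
      have h2 := hq.2 i (by rw [Finset.mem_Icc]; omega)
      have h3 := hq.2 (i - 1) (by rw [Finset.mem_Icc]; omega)
      simp [phi, h1, h2, h3]
    _ ≤ _ := Measure.le_map_apply measurable_phi.aemeasurable _

/-- For `ε < 1/3`, the output measure `ν` does not satisfy the Bowen–Gibbs
property on `Y` for any bounded continuous potential `ψ`: `ν` is not Gibbs. -/
theorem not_bowen_gibbs
    (k : ℤ) (hk : 3 ≤ k) (p : ℤ → ℝ≥0∞)
    (hp : ∀ j, 2 ≤ j → j ≤ k → 0 < p j)
    (hpsum : ∑ j ∈ Finset.Icc 2 k, p j = 1)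
    (ε : ℝ≥0∞) (hε0 : 0 < ε) (hε : ε < 1 / 3)
    (μ π : Measure Seq) [IsProbabilityMeasure μ] [IsProbabilityMeasure π]
    (hμ : IsBernoulliProd μ (srcWt k p)) (hπ : IsBernoulliProd π (jitWt ε))
    (ν : Measure Seq) (hν : ν = (μ.prod π).map fun xw => phi xw.1 xw.2) :
    ¬∃ (ψ : Seq → ℝ) (P C : ℝ),
      ContinuousOn ψ (soficY k) ∧ (∃ M : ℝ, ∀ y ∈ soficY k, |ψ y| ≤ M) ∧ 1 < C ∧
      ∀ y ∈ soficY k, ∀ n : ℕ,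
        C⁻¹ ≤
            (ν {z | z ∈ soficY k ∧ ∀ i : ℤ, 0 ≤ i → i ≤ (n : ℤ) → z i = y i}).toReal /
              Real.exp ((∑ m ∈ Finset.range (n + 1), ψ (shiftL^[m] y)) - (n + 1) * P) ∧
          (ν {z | z ∈ soficY k ∧ ∀ i : ℤ, 0 ≤ i → i ≤ (n : ℤ) → z i = y i}).toReal /
              Real.exp ((∑ m ∈ Finset.range (n + 1), ψ (shiftL^[m] y)) - (n + 1) * P) ≤
            C := by
  rintro ⟨ψ, P, C, -, ⟨M, hM⟩, hC, hgibbs⟩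
  have hk2 : 2 ≤ k := by omega
  have hq0 : 0 < p k := hp k hk2 le_rfl
  have hqtop : p k ≠ ∞ := by
    refine ne_top_of_le_ne_top ENNReal.one_ne_top (hpsum ▸ ?_)
    exact Finset.single_le_sum (f := p) (fun _ _ => zero_le) (Finset.mem_Icc.2 ⟨hk2, le_rfl⟩)
  have hεtop : ε ≠ ∞ := ne_top_of_lt hε
  have hεd : ε < 1 - 2 * ε := by
    have h3 : ε * 3 < 1 := by
      rwa [ENNReal.lt_div_iff_mul_lt (by simp) (by simp)] at hε
    rw [lt_tsub_iff_left]
    convert h3 using 1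
    ring
  have hdtop : 1 - 2 * ε ≠ ∞ := by simp
  set q := (p k).toReal
  set e := ε.toReal
  set d := (1 - 2 * ε).toReal
  have hq : 0 < q := ENNReal.toReal_pos hq0.ne' hqtop
  have he : 0 < e := ENNReal.toReal_pos hε0.ne' hεtop
  have hed : e < d := (ENNReal.toReal_lt_toReal hεtop hdtop).2 hεd
  have hd : 0 < d := he.trans hed
  have hνprob : IsProbabilityMeasure ν :=
    hν ▸ Measure.isProbabilityMeasure_map measurable_phi.aemeasurable
  have hbound : ∀ n : ℕ, d ^ (n + 2) ≤ C * C * Real.exp (M + P) * q * e ^ (n + 2) := by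
    intro n
    have hy := spike_mem_soficY hk2 ((n + 1 : ℕ) : ℤ)
    set y := spike k ((n + 1 : ℕ) : ℤ) with hydef
    have h1 := (hgibbs y hy n).2
    have h2 := (hgibbs y hy (n + 1)).1
    have hset : {z : Seq | z ∈ soficY k ∧ ∀ i : ℤ, 0 ≤ i → i ≤ (n : ℤ) → z i = y i} =
        {z | z ∈ soficY k ∧ ∀ i : ℤ, 0 ≤ i → i ≤ (n : ℤ) → z i = k} := by
      ext z
      refine and_congr_right fun _ => forall₃_congr fun i _ hi => ?_
      rw [hydef, spike, if_neg (by push_cast; omega)]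
    have ha := le_measure_const hk2 hμ hπ n
    have hb := measure_spike_le hk2 hμ hπ (n + 1)
    rw [← hν] at ha hb
    rw [← hset] at ha
    have ha' := ENNReal.toReal_mono (measure_ne_top ν _) ha
    have hb' := ENNReal.toReal_mono (by finiteness) hb
    rw [ENNReal.toReal_mul, ENNReal.toReal_pow, ENNReal.toReal_pow] at ha' hb'
    rw [div_le_iff₀ (Real.exp_pos _)] at h1
    rw [le_div_iff₀ (Real.exp_pos _), Finset.sum_range_succ] at h2
    set S := ∑ m ∈ Finset.range (n + 1), ψ (shiftL^[m] y)
    have hψ := (abs_le.1 (hM _ (shiftL_iterate_mem_soficY hy (n + 1)))).1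
    have h3 : Real.exp (S - (n + 1) * P) ≤ Real.exp (M + P) *
        Real.exp (S + ψ (shiftL^[n + 1] y) - (((n + 1 : ℕ) : ℝ) + 1) * P) := by
      rw [← Real.exp_add]
      gcongr
      push_cast
      linarith
    have hC0 : 0 < C := by linarith
    have h4 := (inv_mul_le_iff₀ hC0).1 (h2.trans hb')
    have h5 : q ^ (n + 1) * d ^ (n + 2) ≤
        q ^ (n + 1) * (C * C * Real.exp (M + P) * q * e ^ (n + 2)) :=
      calc
        _ ≤ C * Real.exp (S - (n + 1) * P) := ha'.trans h1
        _ ≤ C * (Real.exp (M + P) * (C * (q ^ (n + 1 + 1) * e ^ (n + 1 + 1)))) := by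
          gcongr
          exact h3.trans (by gcongr)
        _ = _ := by ring
    exact le_of_mul_le_mul_left h5 (by positivity)
  set K := C * C * Real.exp (M + P) * q
  have hK : 0 < K := by positivity
  obtain ⟨n, hn⟩ := exists_pow_lt_of_lt_one (inv_pos.2 hK) ((div_lt_one hd).2 hed)
  have h1 : (e / d) ^ (n + 2) ≤ (e / d) ^ n :=
    pow_le_pow_of_le_one (by positivity) ((div_lt_one hd).2 hed).le (by omega)
  have h2 := h1.trans_lt hn
  rw [div_pow, div_lt_iff₀ (by positivity), lt_inv_mul_iff₀ hK] at h2
  exact absurd (hbound n) (not_le.2 h2)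


end BitShift
end
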